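/- Let n ≥ 3, ν > 0, and let h : ℝⁿ → ℝⁿ be a divergence-free Schwartz function. Suppose v : [0,∞) × ℝⁿ → ℝⁿ is a classical solution of the Leray projection form of the Navier–Stokes equation, ∂v_i/∂t − νΔv_i + Σ_{j=1}^n v_j ∂v_i/∂x_j = ∫_{ℝⁿ} (∂K_n/∂x_i)(x−y) Σ_{j,k=1}^n (∂v_k/∂x_j · ∂v_j/∂x_k)(t,y) dy with v(0,·) = h, such that v is continuous with continuous first time derivative, has continuous bounded spatial partial derivatives up to third order, and satisfies the decay |∂^α_x v(t,x)| ≤ C·(1+|x|)^{−5} for all spatial multi-indices |α| ≤ 3, uniformly for t in compact intervals. Then Σ_{i=1}^n ∂v_i/∂x_i(t,x) = 0 for all (t,x), and v together with the pressure p(t,x) = −∫_{ℝⁿ} K_n(x−y) Σ_{j,k=1}^n (∂v_k/∂x_j · ∂v_j/∂x_k)(t,y) dy satisfies the incompressible Navier–Stokes equations ∂v_i/∂t − νΔv_i + Σ_j v_j ∂v_i/∂x_j = −∂p/∂x_i pointwise. -/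

import Mathlib

open MeasureTheory Set Filter Topology

noncomputable section

/-- Spatial partial derivative in coordinate direction `j`. -/
noncomputable def pd {n : ℕ} (j : Fin n) (f : EuclideanSpace ℝ (Fin n) → ℝ)
    (x : EuclideanSpace ℝ (Fin n)) : ℝ :=
  fderiv ℝ f x (EuclideanSpace.single j 1)

/-- Iterated spatial partial derivative along a list of coordinate directions
(a spatial multi-index). -/
noncomputable def pdIter {n : ℕ} : List (Fin n) →
    (EuclideanSpace ℝ (Fin n) → ℝ) → EuclideanSpace ℝ (Fin n) → ℝ
  | [], f => f
  | j :: l, f => pd j (pdIter l f)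

/-- Surface area of the unit sphere in ℝⁿ. -/
noncomputable def sphereArea (n : ℕ) : ℝ :=
  n * (volume (Metric.ball (0 : EuclideanSpace ℝ (Fin n)) 1)).toReal

/-- Poisson (Newtonian potential) kernel `K_n x = |x|^(2-n) / ((2-n) ω_n)`. -/
noncomputable def poissonK (n : ℕ) (x : EuclideanSpace ℝ (Fin n)) : ℝ :=
  ‖x‖ ^ ((2 : ℝ) - n) / (((2 : ℝ) - n) * sphereArea n)

/-- Partial derivative of the Poisson kernel: `(∂K_n/∂x_i)(x) = ω_n⁻¹ x_i / |x|ⁿ`. -/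
noncomputable def poissonKGrad (n : ℕ) (i : Fin n) (x : EuclideanSpace ℝ (Fin n)) : ℝ :=
  (sphereArea n)⁻¹ * x i / ‖x‖ ^ n

/-- The pressure associated to a velocity field via the Poisson kernel. -/
noncomputable def nsPressure {n : ℕ} (v : ℝ → EuclideanSpace ℝ (Fin n) → Fin n → ℝ)
    (t : ℝ) (x : EuclideanSpace ℝ (Fin n)) : ℝ :=
  - ∫ y, poissonK n (x - y) *
      ∑ j, ∑ k, pd j (fun z => v t z k) y * pd k (fun z => v t z j) y

section Kernel

theorem integrable_radial_weight {n : ℕ} (hn : 3 ≤ n) :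
    Integrable (fun y : EuclideanSpace ℝ (Fin n) =>
      (‖y‖ ^ (n - 1))⁻¹ * ((1 + ‖y‖) ^ 4)⁻¹) := by
  have : Nontrivial (EuclideanSpace ℝ (Fin n)) :=
    Module.nontrivial_of_finrank_pos (R := ℝ) (by simp; omega)
  refine (integrable_fun_norm_addHaar (volume : Measure (EuclideanSpace ℝ (Fin n)))
    (f := fun r : ℝ => (r ^ (n - 1))⁻¹ * ((1 + r) ^ 4)⁻¹)).2 ?_
  have h1 : IntegrableOn (fun r : ℝ => (1 + ‖r‖) ^ (-(4:ℝ))) (Ioi 0) :=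
    (integrable_one_add_norm (by simp)).integrableOn
  refine h1.congr_fun (fun r hr => ?_) measurableSet_Ioi
  have hr : 0 < r := hr
  have h2 : (0:ℝ) < 1 + r := by linarith
  simp only [Real.norm_eq_abs, abs_of_pos hr, finrank_euclideanSpace, Fintype.card_fin, smul_eq_mul]
  rw [Real.rpow_neg h2.le]
  have : r ^ (n - 1) ≠ 0 := by positivity
  rw [mul_inv_cancel_left₀ this]
  norm_cast

theorem inv_one_add_norm_sub_pow_le {E : Type*} [NormedAddCommGroup E] {x y : E} {R : ℝ}
    (hx : ‖x‖ ≤ R) :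
    ((1 + ‖x - y‖) ^ 5)⁻¹ ≤ (1 + R) ^ 5 * ((1 + ‖y‖) ^ 5)⁻¹ := by
  have h1 : 1 + ‖y‖ ≤ (1 + R) * (1 + ‖x - y‖) := by
    have h2 : ‖y‖ ≤ ‖x‖ + ‖x - y‖ := by
      have := norm_sub_le x (x - y)
      simpa using this
    nlinarith [norm_nonneg x, norm_nonneg (x - y)]
  have h3 : (1 + ‖y‖) ^ 5 ≤ (1 + R) ^ 5 * (1 + ‖x - y‖) ^ 5 := by
    rw [← mul_pow]; gcongr
  rw [← div_eq_mul_inv, inv_eq_one_div, div_le_div_iff₀ (by positivity) (by positivity)]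
  linarith

theorem norm_clm_le_sum {n : ℕ} (L : EuclideanSpace ℝ (Fin n) →L[ℝ] ℝ) :
    ‖L‖ ≤ ∑ i, |L (EuclideanSpace.single i 1)| := by
  refine L.opNorm_le_bound (Finset.sum_nonneg fun i _ => abs_nonneg _) fun x => ?_
  have hx : x = ∑ i, x i • EuclideanSpace.single i (1:ℝ) := by
    ext j
    simp [Finset.sum_apply, Pi.single_apply]
  have : L x = ∑ i, x i * L (EuclideanSpace.single i (1:ℝ)) := by
    conv_lhs => rw [hx]
    simp
  rw [this, Finset.sum_mul]
  refine (norm_sum_le _ _).trans (Finset.sum_le_sum fun i _ => ?_)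
  rw [norm_mul, mul_comm]
  gcongr
  · exact le_of_eq rfl
  · exact PiLp.norm_apply_le x i

/-- A kernel whose product with the weight `(1 + ‖y‖)⁻⁵` is integrable. -/
structure TamedKernel {n : ℕ} (k : EuclideanSpace ℝ (Fin n) → ℝ) : Prop where
  meas : AEStronglyMeasurable k volume
  int : Integrable (fun y => |k y| * ((1 + ‖y‖) ^ 5)⁻¹)

/-- Fifth order polynomial decay with constant `C`. -/
def DecaysWith {n : ℕ} {F : Type*} [Norm F] (C : ℝ) (g : EuclideanSpace ℝ (Fin n) → F) : Prop :=
  ∀ x, ‖g x‖ ≤ C * ((1 + ‖x‖) ^ 5)⁻¹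

theorem DecaysWith.nonneg {n : ℕ} {F : Type*} [SeminormedAddCommGroup F] {C : ℝ}
    {g : EuclideanSpace ℝ (Fin n) → F}
    (hg : DecaysWith C g) : 0 ≤ C := by
  simpa using (norm_nonneg _).trans (hg 0)

theorem DecaysWith.norm_sub_le {n : ℕ} {F : Type*} [SeminormedAddCommGroup F] {C R : ℝ}
    {g : EuclideanSpace ℝ (Fin n) → F} (hg : DecaysWith C g) {x : EuclideanSpace ℝ (Fin n)}
    (hx : ‖x‖ ≤ R) (y : EuclideanSpace ℝ (Fin n)) :
    ‖g (x - y)‖ ≤ C * (1 + R) ^ 5 * ((1 + ‖y‖) ^ 5)⁻¹ := by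
  refine (hg _).trans ?_
  rw [mul_assoc]
  exact mul_le_mul_of_nonneg_left (inv_one_add_norm_sub_pow_le hx) hg.nonneg

theorem DecaysWith.norm_mul_le {n : ℕ} {F : Type*} [NormedAddCommGroup F] [NormedSpace ℝ F]
    {C R : ℝ} {g : EuclideanSpace ℝ (Fin n) → F} (hg : DecaysWith C g)
    (k : EuclideanSpace ℝ (Fin n) → ℝ) {x : EuclideanSpace ℝ (Fin n)}
    (hx : ‖x‖ ≤ R) (y : EuclideanSpace ℝ (Fin n)) :
    ‖k y • g (x - y)‖ ≤ C * (1 + R) ^ 5 * (|k y| * ((1 + ‖y‖) ^ 5)⁻¹) := by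
  rw [norm_smul, Real.norm_eq_abs]
  calc |k y| * ‖g (x - y)‖ ≤ |k y| * (C * (1 + R) ^ 5 * ((1 + ‖y‖) ^ 5)⁻¹) := by
        gcongr; exact hg.norm_sub_le hx y
    _ = _ := by ring

theorem DecaysWith.fderiv_of_pd {n : ℕ} {C : ℝ} {g : EuclideanSpace ℝ (Fin n) → ℝ}
    (hg : ∀ i, DecaysWith C (pd i g)) : DecaysWith (n * C) (fderiv ℝ g) := fun z => by
  refine (norm_clm_le_sum _).trans ?_
  refine (Finset.sum_le_sum fun i _ => hg i z).trans ?_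
  simp [mul_assoc]

namespace TamedKernel

theorem integrable_smul {n : ℕ} {F : Type*} [NormedAddCommGroup F] [NormedSpace ℝ F]
    {k : EuclideanSpace ℝ (Fin n) → ℝ} (hk : TamedKernel k)
    {C : ℝ} {g : EuclideanSpace ℝ (Fin n) → F} (hg : DecaysWith C g)
    (hgc : Continuous g) (x : EuclideanSpace ℝ (Fin n)) :
    Integrable (fun y => k y • g (x - y)) := by
  refine (hk.int.const_mul (C * (1 + ‖x‖) ^ 5)).mono' ?_
    (.of_forall fun y => hg.norm_mul_le k le_rfl y)
  exact hk.meas.smul (hgc.comp (continuous_const.sub continuous_id)).aestronglyMeasurable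

theorem abs_integral_le {n : ℕ} {k : EuclideanSpace ℝ (Fin n) → ℝ} (hk : TamedKernel k)
    {C R : ℝ} {g : EuclideanSpace ℝ (Fin n) → ℝ} (hg : DecaysWith C g)
    {x : EuclideanSpace ℝ (Fin n)} (hx : ‖x‖ ≤ R) :
    |∫ y, k y * g (x - y)| ≤ C * (1 + R) ^ 5 * ∫ y, |k y| * ((1 + ‖y‖) ^ 5)⁻¹ := by
  rw [← integral_const_mul, ← Real.norm_eq_abs]
  exact norm_integral_le_of_norm_le (hk.int.const_mul _)
    (.of_forall fun y => hg.norm_mul_le k hx y)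

theorem hasFDerivAt_integral {n : ℕ} {k : EuclideanSpace ℝ (Fin n) → ℝ} (hk : TamedKernel k)
    {C C' : ℝ} {g : EuclideanSpace ℝ (Fin n) → ℝ} (hg : DecaysWith C g)
    (hg1 : ContDiff ℝ 1 g) (hg' : DecaysWith C' (fderiv ℝ g)) (x : EuclideanSpace ℝ (Fin n)) :
    HasFDerivAt (fun x => ∫ y, k y * g (x - y)) (∫ y, k y • fderiv ℝ g (x - y)) x := by
  refine hasFDerivAt_integral_of_dominated_of_fderiv_le
    (F := fun x y => k y * g (x - y)) (F' := fun x y => k y • fderiv ℝ g (x - y))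
    (bound := fun y => C' * (1 + (‖x‖ + 1)) ^ 5 * (|k y| * ((1 + ‖y‖) ^ 5)⁻¹))
    (Metric.ball_mem_nhds x one_pos)
    (.of_forall fun z => (hk.integrable_smul hg hg1.continuous z).1)
    (hk.integrable_smul hg hg1.continuous x)
    (hk.integrable_smul hg' (hg1.continuous_fderiv one_ne_zero) x).1
    (.of_forall fun y z hz => hg'.norm_mul_le k ?_ y) (hk.int.const_mul _)
    (.of_forall fun y z _ => ?_)
  · have := norm_sub_norm_le z x
    rw [Metric.mem_ball, dist_eq_norm] at hz
    linarith
  · have h1 := ((hg1.differentiable one_ne_zero) (z - y)).hasFDerivAt.comp z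
      ((hasFDerivAt_id z).sub_const y)
    simpa using h1.const_mul (k y)

theorem hasFDerivAt_pd {n : ℕ} {k : EuclideanSpace ℝ (Fin n) → ℝ} (hk : TamedKernel k)
    {C C' : ℝ} {g : EuclideanSpace ℝ (Fin n) → ℝ} (hg : DecaysWith C g)
    (hg1 : ContDiff ℝ 1 g) (hg' : ∀ i, DecaysWith C' (pd i g)) (x : EuclideanSpace ℝ (Fin n)) :
    DifferentiableAt ℝ (fun x => ∫ y, k y * g (x - y)) x ∧
    ∀ i, pd i (fun x => ∫ y, k y * g (x - y)) x = ∫ y, k y * pd i g (x - y) := by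
  have h1 := DecaysWith.fderiv_of_pd hg'
  have h2 := hk.hasFDerivAt_integral hg hg1 h1 x
  refine ⟨h2.differentiableAt, fun i => ?_⟩
  rw [pd, h2.fderiv, ContinuousLinearMap.integral_apply
    (hk.integrable_smul h1 (hg1.continuous_fderiv one_ne_zero) x)]
  rfl

theorem continuousOn_integral {n : ℕ} {k : EuclideanSpace ℝ (Fin n) → ℝ} (hk : TamedKernel k)
    {C : ℝ} {g : ℝ → EuclideanSpace ℝ (Fin n) → ℝ} {s : Set ℝ}
    (hg : ∀ t ∈ s, DecaysWith C (g t)) (hgx : ∀ t ∈ s, Continuous (g t))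
    (hgt : ∀ y, ContinuousOn (fun t => g t y) s) (x : EuclideanSpace ℝ (Fin n)) :
    ContinuousOn (fun t => ∫ y, k y * g t (x - y)) s := by
  refine continuousOn_of_dominated
    (bound := fun y => C * (1 + ‖x‖) ^ 5 * (|k y| * ((1 + ‖y‖) ^ 5)⁻¹))
    (fun t ht => (hk.integrable_smul (hg t ht) (hgx t ht) x).1)
    (fun t ht => .of_forall fun y => (hg t ht).norm_mul_le k le_rfl y) (hk.int.const_mul _)
    (.of_forall fun y => continuousOn_const.mul (hgt _))

end TamedKernel

end Kernel

section Poisson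

theorem sphereArea_pos {n : ℕ} (hn : 3 ≤ n) : 0 < sphereArea n := by
  have h1 : 0 < (volume (Metric.ball (0 : EuclideanSpace ℝ (Fin n)) 1)).toReal :=
    ENNReal.toReal_pos (Metric.measure_ball_pos _ _ one_pos).ne' measure_ball_lt_top.ne
  have h2 : (0:ℝ) < n := by exact_mod_cast (by omega : 0 < n)
  exact mul_pos h2 h1

theorem ae_ne_zero {n : ℕ} (hn : 3 ≤ n) : ∀ᵐ y : EuclideanSpace ℝ (Fin n), y ≠ 0 := by
  have : Nontrivial (EuclideanSpace ℝ (Fin n)) :=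
    Module.nontrivial_of_finrank_pos (R := ℝ) (by simp; omega)
  exact Measure.ae_ne volume 0

/-- The Poisson kernel with `‖y‖²` replaced by `‖y‖² + δ`. -/
noncomputable def regPoissonK (n : ℕ) (δ : ℝ) (y : EuclideanSpace ℝ (Fin n)) : ℝ :=
  (‖y‖ ^ 2 + δ) ^ (((2 : ℝ) - n) / 2) / (((2 : ℝ) - n) * sphereArea n)

/-- The partial derivative of `regPoissonK`. -/
noncomputable def regPoissonKGrad (n : ℕ) (δ : ℝ) (i : Fin n) (y : EuclideanSpace ℝ (Fin n)) : ℝ :=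
  (sphereArea n)⁻¹ * y i * (‖y‖ ^ 2 + δ) ^ (-(n : ℝ) / 2)

theorem regPoissonK_zero (n : ℕ) : regPoissonK n 0 = poissonK n := by
  ext y
  rw [regPoissonK, poissonK, add_zero, ← Real.rpow_natCast ‖y‖ 2, ← Real.rpow_mul (norm_nonneg y)]
  congr 2
  push_cast
  ring

theorem regPoissonKGrad_zero (n : ℕ) (i : Fin n) : regPoissonKGrad n 0 i = poissonKGrad n i := by
  ext y
  rw [regPoissonKGrad, poissonKGrad, add_zero, ← Real.rpow_natCast ‖y‖ 2,
    ← Real.rpow_mul (norm_nonneg y), div_eq_mul_inv _ (‖y‖ ^ n), ← Real.rpow_natCast ‖y‖ n,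
    ← Real.rpow_neg (norm_nonneg y)]
  congr 2
  push_cast
  ring

theorem measurable_regPoissonK (n : ℕ) (δ : ℝ) : Measurable (regPoissonK n δ) := by
  unfold regPoissonK
  fun_prop

theorem measurable_regPoissonKGrad (n : ℕ) (δ : ℝ) (i : Fin n) :
    Measurable (regPoissonKGrad n δ i) := by
  unfold regPoissonKGrad
  fun_prop

theorem add_rpow_le_rpow_of_nonpos {a δ p : ℝ} (ha : 0 < a) (hδ : 0 ≤ δ) (hp : p ≤ 0) :
    |(a + δ) ^ p| ≤ |(a + 0) ^ p| := by
  rw [abs_of_nonneg (by positivity), abs_of_nonneg (by positivity), add_zero]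
  exact Real.rpow_le_rpow_of_nonpos ha (by linarith) hp

theorem abs_regPoissonK_le {n : ℕ} (hn : 3 ≤ n) {δ : ℝ} (hδ : 0 ≤ δ)
    {y : EuclideanSpace ℝ (Fin n)} (hy : y ≠ 0) : |regPoissonK n δ y| ≤ |poissonK n y| := by
  have h2 : (3:ℝ) ≤ n := by exact_mod_cast hn
  rw [← regPoissonK_zero, regPoissonK, regPoissonK, abs_div, abs_div]
  gcongr ?_ / _
  exact add_rpow_le_rpow_of_nonpos (by positivity) hδ (by linarith)

theorem abs_regPoissonKGrad_le {n : ℕ} {δ : ℝ} (hδ : 0 ≤ δ) (i : Fin n)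
    {y : EuclideanSpace ℝ (Fin n)} (hy : y ≠ 0) :
    |regPoissonKGrad n δ i y| ≤ |poissonKGrad n i y| := by
  have h2 : (0:ℝ) ≤ n := by positivity
  rw [← regPoissonKGrad_zero, regPoissonKGrad, regPoissonKGrad, abs_mul, abs_mul _ (_ ^ _)]
  gcongr _ * ?_
  exact add_rpow_le_rpow_of_nonpos (by positivity) hδ (by linarith)

theorem tamedKernel_poissonK {n : ℕ} (hn : 3 ≤ n) : TamedKernel (poissonK n) := by
  have hm : AEStronglyMeasurable (poissonK n) volume := by
    rw [← regPoissonK_zero]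
    exact (measurable_regPoissonK n 0).aestronglyMeasurable
  refine ⟨hm, ((integrable_radial_weight hn).const_mul
    |(((2 : ℝ) - n) * sphereArea n)⁻¹|).mono' ?_ ?_⟩
  · exact hm.norm.mul (by fun_prop : Measurable _).aestronglyMeasurable
  · filter_upwards [ae_ne_zero hn] with y hy
    have hy : 0 < ‖y‖ := norm_pos_iff.2 hy
    have h1 : ‖y‖ ^ ((2:ℝ) - n) = ‖y‖ * (‖y‖ ^ (n - 1))⁻¹ := by
      have : (2:ℝ) - n = 1 + (-((n - 1 : ℕ) : ℝ)) := by
        rw [Nat.cast_sub (by omega)]; push_cast; ring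
      rw [this, Real.rpow_add hy, Real.rpow_neg hy.le, Real.rpow_one, Real.rpow_natCast]
    rw [Real.norm_eq_abs, abs_of_nonneg (by positivity), poissonK, div_eq_mul_inv, abs_mul, h1,
      abs_of_nonneg (by positivity : 0 ≤ ‖y‖ * (‖y‖ ^ (n - 1))⁻¹)]
    have h3 : ‖y‖ * ((1 + ‖y‖) ^ 5)⁻¹ ≤ ((1 + ‖y‖) ^ 4)⁻¹ := by
      rw [← div_eq_mul_inv, inv_eq_one_div, div_le_div_iff₀ (by positivity) (by positivity)]
      have : 0 ≤ (1 + ‖y‖) ^ 4 := by positivity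
      nlinarith
    calc _ = |(((2 : ℝ) - n) * sphereArea n)⁻¹| *
          ((‖y‖ ^ (n - 1))⁻¹ * (‖y‖ * ((1 + ‖y‖) ^ 5)⁻¹)) := by ring
      _ ≤ _ := by gcongr

theorem tamedKernel_poissonKGrad {n : ℕ} (hn : 3 ≤ n) (i : Fin n) :
    TamedKernel (poissonKGrad n i) := by
  have hm : AEStronglyMeasurable (poissonKGrad n i) volume := by
    rw [← regPoissonKGrad_zero]
    exact (measurable_regPoissonKGrad n 0 i).aestronglyMeasurable
  refine ⟨hm, ((integrable_radial_weight hn).const_mul (sphereArea n)⁻¹).mono' ?_ ?_⟩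
  · exact hm.norm.mul (by fun_prop : Measurable _).aestronglyMeasurable
  · filter_upwards [ae_ne_zero hn] with y hy
    have hy : 0 < ‖y‖ := norm_pos_iff.2 hy
    have hω := sphereArea_pos hn
    rw [Real.norm_eq_abs, abs_of_nonneg (by positivity), poissonKGrad, abs_div, abs_mul,
      abs_of_pos (inv_pos.2 hω), abs_of_pos (pow_pos hy n)]
    have h1 : |y i| / ‖y‖ ^ n ≤ (‖y‖ ^ (n - 1))⁻¹ := by
      have h0 : |y i| ≤ ‖y‖ := PiLp.norm_apply_le y i
      have : ‖y‖ ^ n = ‖y‖ ^ (n - 1) * ‖y‖ := by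
        rw [← pow_succ]; congr 1; omega
      rw [this, inv_eq_one_div, div_le_div_iff₀ (by positivity) (by positivity)]
      have : 0 < ‖y‖ ^ (n - 1) := by positivity
      nlinarith
    have h3 : ((1 + ‖y‖) ^ 5)⁻¹ ≤ ((1 + ‖y‖) ^ 4)⁻¹ := by
      gcongr
      · linarith
      · norm_num
    calc _ = (sphereArea n)⁻¹ * ((|y i| / ‖y‖ ^ n) * ((1 + ‖y‖) ^ 5)⁻¹) := by ring
      _ ≤ _ := by gcongr

theorem TamedKernel.of_abs_le {n : ℕ} {k k' : EuclideanSpace ℝ (Fin n) → ℝ} (hk : TamedKernel k)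
    (hm : Measurable k') (h : ∀ᵐ y, |k' y| ≤ |k y|) : TamedKernel k' := by
  refine ⟨hm.aestronglyMeasurable, hk.int.mono' ?_ ?_⟩
  · fun_prop
  · filter_upwards [h] with y hy
    rw [Real.norm_eq_abs, abs_of_nonneg (by positivity)]
    gcongr

theorem hasLineDerivAt_regPoissonK {n : ℕ} (hn : 3 ≤ n) {δ : ℝ} (hδ : 0 < δ) (i : Fin n)
    (y : EuclideanSpace ℝ (Fin n)) :
    HasLineDerivAt ℝ (regPoissonK n δ) (regPoissonKGrad n δ i y) y (EuclideanSpace.single i 1) := by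
  have h1 := (((hasStrictFDerivAt_norm_sq y).hasFDerivAt.add_const δ).rpow_const
    (p := ((2 : ℝ) - n) / 2) (Or.inl (by positivity))).mul_const
      ((((2 : ℝ) - n) * sphereArea n)⁻¹)
  have h2 := h1.hasLineDerivAt (EuclideanSpace.single i 1)
  have h3 : (3:ℝ) ≤ n := by exact_mod_cast hn
  have h4 : (2:ℝ) - n ≠ 0 := by linarith
  have hω := sphereArea_pos hn
  convert! h2 using 1
  have h5 : ((2:ℝ) - n) / 2 - 1 = -(n:ℝ) / 2 := by ring
  simp only [h5, regPoissonKGrad, smul_apply, innerSL_apply_apply,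
    EuclideanSpace.inner_single_right, smul_eq_mul, nsmul_eq_mul]
  simp
  field_simp

theorem hasLineDerivAt_comp_sub {n : ℕ} {g : EuclideanSpace ℝ (Fin n) → ℝ} (hg : ContDiff ℝ 1 g)
    (x y : EuclideanSpace ℝ (Fin n)) (i : Fin n) :
    HasLineDerivAt ℝ (fun y => g (x - y)) (-pd i g (x - y)) y (EuclideanSpace.single i 1) := by
  have h1 := (((hg.differentiable one_ne_zero) (x - y)).hasFDerivAt.comp y
      ((hasFDerivAt_id y).const_sub x)).hasLineDerivAt (EuclideanSpace.single i 1)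
  simpa [pd] using! h1

theorem continuous_pd {n : ℕ} {g : EuclideanSpace ℝ (Fin n) → ℝ} (hg : ContDiff ℝ 1 g)
    (i : Fin n) : Continuous (pd i g) :=
  (hg.continuous_fderiv one_ne_zero).clm_apply continuous_const

theorem integral_regPoissonK_mul_pd {n : ℕ} (hn : 3 ≤ n) {δ : ℝ} (hδ : 0 < δ) {C C' : ℝ}
    {g : EuclideanSpace ℝ (Fin n) → ℝ} (hg : DecaysWith C g)
    (hg1 : ContDiff ℝ 1 g) (hg' : ∀ i, DecaysWith C' (pd i g)) (x : EuclideanSpace ℝ (Fin n))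
    (i : Fin n) :
    ∫ y, regPoissonK n δ y * pd i g (x - y) = ∫ y, regPoissonKGrad n δ i y * g (x - y) := by
  have hk : TamedKernel (regPoissonK n δ) :=
    (tamedKernel_poissonK hn).of_abs_le (measurable_regPoissonK n δ)
      ((ae_ne_zero hn).mono fun y hy => abs_regPoissonK_le hn hδ.le hy)
  have hk' : TamedKernel (regPoissonKGrad n δ i) :=
    (tamedKernel_poissonKGrad hn i).of_abs_le (measurable_regPoissonKGrad n δ i)
      ((ae_ne_zero hn).mono fun y hy => abs_regPoissonKGrad_le hδ.le i hy)
  have h := integral_bilinear_hasLineDerivAt_right_eq_neg_left_of_integrable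
    (μ := (volume : Measure (EuclideanSpace ℝ (Fin n)))) (f := regPoissonK n δ)
    (f' := regPoissonKGrad n δ i) (g := fun y => g (x - y)) (g' := fun y => -pd i g (x - y))
    (v := EuclideanSpace.single i 1) (B := ContinuousLinearMap.mul ℝ ℝ)
    (hk'.integrable_smul hg hg1.continuous x)
    (by simpa using (hk.integrable_smul (hg' i) (continuous_pd hg1 i) x).neg)
    (hk.integrable_smul hg hg1.continuous x)
    (fun y _ => hasLineDerivAt_regPoissonK hn hδ i y)
    (fun y _ => hasLineDerivAt_comp_sub hg1 x y i)
  simp only [ContinuousLinearMap.mul_apply', mul_neg, integral_neg, neg_inj] at h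
  exact h

theorem tendsto_add_rpow {a : ℝ} (ha : 0 < a) (p : ℝ) :
    Tendsto (fun δ : ℝ => (a + δ) ^ p) (𝓝[>] 0) (𝓝 ((a + 0) ^ p)) := by
  have : ContinuousAt (fun δ : ℝ => (a + δ) ^ p) 0 :=
    (continuousAt_const.add continuousAt_id).rpow_const (Or.inl (by simpa using ha.ne'))
  exact this.tendsto.mono_left nhdsWithin_le_nhds

theorem integral_poissonK_mul_pd {n : ℕ} (hn : 3 ≤ n) {C C' : ℝ}
    {g : EuclideanSpace ℝ (Fin n) → ℝ} (hg : DecaysWith C g)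
    (hg1 : ContDiff ℝ 1 g) (hg' : ∀ i, DecaysWith C' (pd i g)) (x : EuclideanSpace ℝ (Fin n))
    (i : Fin n) :
    ∫ y, poissonK n y * pd i g (x - y) = ∫ y, poissonKGrad n i y * g (x - y) := by
  have hc : Continuous fun y => g (x - y) :=
    hg1.continuous.comp (continuous_const.sub continuous_id)
  have hc' : Continuous fun y => pd i g (x - y) :=
    (continuous_pd hg1 i).comp (continuous_const.sub continuous_id)
  have h1 : Tendsto (fun δ => ∫ y, regPoissonK n δ y * pd i g (x - y)) (𝓝[>] 0)
      (𝓝 (∫ y, poissonK n y * pd i g (x - y))) := by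
    refine tendsto_integral_filter_of_dominated_convergence
      (fun y => ‖poissonK n y * pd i g (x - y)‖)
      (.of_forall fun δ => (measurable_regPoissonK n δ).aestronglyMeasurable.mul
        hc'.aestronglyMeasurable) ?_
      ((tamedKernel_poissonK hn).integrable_smul (hg' i) (continuous_pd hg1 i) x).norm ?_
    · filter_upwards [self_mem_nhdsWithin] with δ hδ
      filter_upwards [ae_ne_zero hn] with y hy
      rw [norm_mul, norm_mul]
      gcongr
      exact abs_regPoissonK_le hn (le_of_lt hδ) hy
    · filter_upwards [ae_ne_zero hn] with y hy
      rw [← regPoissonK_zero]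
      exact ((tendsto_add_rpow (by positivity) _).div_const _).mul_const _
  have h2 : Tendsto (fun δ => ∫ y, regPoissonKGrad n δ i y * g (x - y)) (𝓝[>] 0)
      (𝓝 (∫ y, poissonKGrad n i y * g (x - y))) := by
    refine tendsto_integral_filter_of_dominated_convergence
      (fun y => ‖poissonKGrad n i y * g (x - y)‖)
      (.of_forall fun δ => (measurable_regPoissonKGrad n δ i).aestronglyMeasurable.mul
        hc.aestronglyMeasurable) ?_
      ((tamedKernel_poissonKGrad hn i).integrable_smul hg hg1.continuous x).norm ?_
    · filter_upwards [self_mem_nhdsWithin] with δ hδ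
      filter_upwards [ae_ne_zero hn] with y hy
      rw [norm_mul, norm_mul]
      gcongr
      exact abs_regPoissonKGrad_le (le_of_lt hδ) i hy
    · filter_upwards [ae_ne_zero hn] with y hy
      rw [← regPoissonKGrad_zero]
      exact ((tendsto_add_rpow (by positivity) _).const_mul _).mul_const _
  refine tendsto_nhds_unique h1 (h2.congr' ?_)
  filter_upwards [self_mem_nhdsWithin] with δ hδ
  exact (integral_regPoissonK_mul_pd hn hδ hg hg1 hg' x i).symm

end Poisson

section FundamentalSolution

theorem integral_eq_integral_sphere {n : ℕ} (hn : 3 ≤ n) {Q : EuclideanSpace ℝ (Fin n) → ℝ}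
    (hQ : Integrable Q) :
    ∫ y, Q y = ∫ θ : Metric.sphere (0 : EuclideanSpace ℝ (Fin n)) 1,
      (∫ r in Ioi (0:ℝ), r ^ (n - 1) * Q (r • (θ : EuclideanSpace ℝ (Fin n))))
      ∂(volume : Measure (EuclideanSpace ℝ (Fin n))).toSphere := by
  have : Nontrivial (EuclideanSpace ℝ (Fin n)) :=
    Module.nontrivial_of_finrank_pos (R := ℝ) (by simp; omega)
  set μ : Measure (EuclideanSpace ℝ (Fin n)) := volume with hμ
  have hmp := μ.measurePreserving_homeomorphUnitSphereProd
  have hemb := Homeomorph.measurableEmbedding (homeomorphUnitSphereProd (EuclideanSpace ℝ (Fin n)))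
  set P : Metric.sphere (0 : EuclideanSpace ℝ (Fin n)) 1 × Ioi (0:ℝ) → ℝ :=
    fun p => Q ((p.2 : ℝ) • (p.1 : EuclideanSpace ℝ (Fin n))) with hP
  have hcomp : ∀ y : ({0}ᶜ : Set (EuclideanSpace ℝ (Fin n))),
      P (homeomorphUnitSphereProd _ y) = Q y := by
    intro y
    have hy : ‖(y : EuclideanSpace ℝ (Fin n))‖ ≠ 0 := norm_ne_zero_iff.2 y.2
    simp [hP, smul_smul, hy]
  have hinteg : Integrable P (μ.toSphere.prod (.volumeIoiPow (n - 1))) := by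
    have h1 := hmp.integrable_comp_emb hemb (g := P)
    rw [finrank_euclideanSpace, Fintype.card_fin] at h1
    rw [← h1]
    have h2 : IntegrableOn Q ({0}ᶜ) μ := hQ.integrableOn
    rw [integrableOn_iff_comap_subtypeVal (measurableSet_singleton _).compl] at h2
    exact h2.congr (.of_forall fun y => (hcomp y).symm)
  calc ∫ y, Q y ∂μ = ∫ y : ({0}ᶜ : Set (EuclideanSpace ℝ (Fin n))), Q y ∂(μ.comap (↑)) := by
        rw [integral_subtype_comap (measurableSet_singleton _).compl Q, restrict_compl_singleton]
    _ = ∫ p, P p ∂(μ.toSphere.prod (.volumeIoiPow (n - 1))) := by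
        have h1 := hmp.integral_comp hemb P
        rw [finrank_euclideanSpace, Fintype.card_fin] at h1
        rw [← h1]
        exact integral_congr_ae (.of_forall fun y => (hcomp y).symm)
    _ = ∫ θ, (∫ r, P (θ, r) ∂(Measure.volumeIoiPow (n - 1))) ∂μ.toSphere := integral_prod _ hinteg
    _ = _ := by
        refine integral_congr_ae (.of_forall fun θ => ?_)
        simp only [Measure.volumeIoiPow, ENNReal.ofReal, hP]
        rw [integral_withDensity_eq_integral_smul,
          integral_subtype_comap measurableSet_Ioi fun a =>
            Real.toNNReal (a ^ (n - 1)) • Q (a • (θ : EuclideanSpace ℝ (Fin n)))]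
        · refine setIntegral_congr_fun measurableSet_Ioi fun x hx => ?_
          simp only [NNReal.smul_def, Real.coe_toNNReal _ (pow_nonneg (le_of_lt hx) _), smul_eq_mul]
        · exact (measurable_subtype_coe.pow_const _).real_toNNReal

theorem tendsto_inv_one_add_pow :
    Tendsto (fun r : ℝ => ((1 + r) ^ 5)⁻¹) atTop (𝓝 0) :=
  ((tendsto_pow_atTop (by norm_num)).comp
    (tendsto_atTop_add_const_left _ _ tendsto_id)).inv_tendsto_atTop

theorem integral_fderiv_ray {n : ℕ} {C C' : ℝ}
    {g : EuclideanSpace ℝ (Fin n) → ℝ} (hg : DecaysWith C g)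
    (hg1 : ContDiff ℝ 1 g) (hg' : DecaysWith C' (fderiv ℝ g)) (x θ : EuclideanSpace ℝ (Fin n))
    (hθ : ‖θ‖ = 1) :
    ∫ r in Ioi (0:ℝ), fderiv ℝ g (x - r • θ) θ = g x := by
  have hn : ∀ r ∈ Ioi (0:ℝ), ‖r • θ‖ = r := fun r hr => by
    rw [norm_smul, hθ, mul_one, Real.norm_eq_abs, abs_of_pos hr]
  have hc : Continuous fun r : ℝ => x - r • θ := by fun_prop
  have hd : ∀ r ∈ Ici (0:ℝ), HasDerivAt (fun r : ℝ => g (x - r • θ))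
      (-(fderiv ℝ g (x - r • θ) θ)) r := by
    intro r _
    have h1 : HasDerivAt (fun r : ℝ => x - r • θ) (-θ) r := by
      simpa using ((hasDerivAt_id r).smul_const θ).const_sub x
    have h2 := ((hg1.differentiable one_ne_zero) (x - r • θ)).hasFDerivAt.comp_hasDerivAt r h1
    simpa using! h2
  have hinteg : IntegrableOn (fun r : ℝ => -(fderiv ℝ g (x - r • θ) θ)) (Ioi 0) := by
    have h1 : IntegrableOn (fun r : ℝ => C' * (1 + ‖x‖) ^ 5 * (1 + ‖r‖) ^ (-(5:ℝ))) (Ioi 0) :=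
      ((integrable_one_add_norm (by simp)).const_mul _).integrableOn
    refine Integrable.mono' h1 ?_ ?_
    · exact (((hg1.continuous_fderiv one_ne_zero).comp hc).clm_apply
        continuous_const).neg.aestronglyMeasurable
    · refine (ae_restrict_iff' measurableSet_Ioi).2 (.of_forall fun r hr => ?_)
      have hr' : (0:ℝ) < r := hr
      have h2 := hg'.norm_sub_le (le_refl ‖x‖) (r • θ)
      rw [hn r hr] at h2
      rw [Real.norm_eq_abs r, abs_of_pos hr', Real.rpow_neg (by positivity), norm_neg]
      refine ((fderiv ℝ g (x - r • θ)).le_opNorm θ).trans ?_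
      rw [hθ, mul_one]
      exact_mod_cast h2
  have ht : Tendsto (fun r : ℝ => g (x - r • θ)) atTop (𝓝 0) := by
    refine squeeze_zero_norm' (a := fun r => C * (1 + ‖x‖) ^ 5 * ((1 + r) ^ 5)⁻¹) ?_ ?_
    · filter_upwards [eventually_gt_atTop 0] with r hr
      have h2 := hg.norm_sub_le (le_refl ‖x‖) (r • θ)
      rwa [hn r hr] at h2
    · simpa using tendsto_inv_one_add_pow.const_mul (C * (1 + ‖x‖) ^ 5)
  have h := integral_Ioi_of_hasDerivAt_of_tendsto' hd hinteg ht
  rw [integral_neg] at h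
  simp only [zero_smul, sub_zero, zero_sub, neg_inj] at h
  exact h

theorem sum_mul_pd_eq_fderiv {n : ℕ} (g : EuclideanSpace ℝ (Fin n) → ℝ)
    (x v : EuclideanSpace ℝ (Fin n)) : ∑ i, v i * pd i g x = fderiv ℝ g x v := by
  have hx : v = ∑ i, v i • EuclideanSpace.single i (1:ℝ) := by
    ext j
    simp [Finset.sum_apply, Pi.single_apply]
  conv_rhs => rw [hx]
  simp [pd]

theorem sum_integral_poissonKGrad_mul_pd {n : ℕ} (hn : 3 ≤ n) {C C' : ℝ}
    {g : EuclideanSpace ℝ (Fin n) → ℝ} (hg : DecaysWith C g)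
    (hg1 : ContDiff ℝ 1 g) (hg' : ∀ i, DecaysWith C' (pd i g)) (x : EuclideanSpace ℝ (Fin n)) :
    ∑ i, ∫ y, poissonKGrad n i y * pd i g (x - y) = g x := by
  have hω := sphereArea_pos hn
  have hinteg : ∀ i ∈ Finset.univ, Integrable fun y => poissonKGrad n i y * pd i g (x - y) :=
    fun i _ => (tamedKernel_poissonKGrad hn i).integrable_smul (hg' i) (continuous_pd hg1 i) x
  rw [← integral_finsetSum _ hinteg,
    integral_eq_integral_sphere hn (integrable_finsetSum _ hinteg)]
  have hinner : ∀ θ : Metric.sphere (0 : EuclideanSpace ℝ (Fin n)) 1,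
      (∫ r in Ioi (0:ℝ), r ^ (n - 1) * ∑ i, poissonKGrad n i (r • (θ : EuclideanSpace ℝ (Fin n)))
        * pd i g (x - r • (θ : EuclideanSpace ℝ (Fin n)))) = (sphereArea n)⁻¹ * g x := by
    intro θ
    have hθ : ‖(θ : EuclideanSpace ℝ (Fin n))‖ = 1 := norm_eq_of_mem_sphere θ
    rw [← integral_fderiv_ray hg hg1 (DecaysWith.fderiv_of_pd hg') x θ hθ, ← integral_const_mul]
    refine setIntegral_congr_fun measurableSet_Ioi fun r hr => ?_
    have hr : 0 < r := hr
    have hpow : r ^ n = r ^ (n - 1) * r := by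
      rw [← pow_succ]; congr 1; omega
    simp only [poissonKGrad, norm_smul, hθ, mul_one, Real.norm_eq_abs, abs_of_pos hr]
    rw [← sum_mul_pd_eq_fderiv, Finset.mul_sum, Finset.mul_sum]
    refine Finset.sum_congr rfl fun i _ => ?_
    rw [hpow]
    simp only [PiLp.smul_apply, smul_eq_mul]
    field_simp
  simp only [hinner]
  rw [integral_const, Measure.toSphere_real_apply_univ, finrank_euclideanSpace, Fintype.card_fin,
    smul_eq_mul]
  change sphereArea n * _ = _
  field_simp

end FundamentalSolution

section PartialDerivatives

theorem contDiff_pd {n : ℕ} {m k : WithTop ℕ∞} {f : EuclideanSpace ℝ (Fin n) → ℝ}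
    (hf : ContDiff ℝ k f) (hm : m + 1 ≤ k) (j : Fin n) : ContDiff ℝ m (pd j f) :=
  (hf.fderiv_right hm).clm_apply contDiff_const

theorem pd_sum {n : ℕ} {ι : Type*} (s : Finset ι) {f : ι → EuclideanSpace ℝ (Fin n) → ℝ}
    {x : EuclideanSpace ℝ (Fin n)} (hf : ∀ a ∈ s, DifferentiableAt ℝ (f a) x) (j : Fin n) :
    pd j (fun y => ∑ a ∈ s, f a y) x = ∑ a ∈ s, pd j (f a) x := by
  simp only [pd]
  rw [fderiv_fun_sum hf]
  simp

theorem pd_add {n : ℕ} {f g : EuclideanSpace ℝ (Fin n) → ℝ}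
    {x : EuclideanSpace ℝ (Fin n)} (hf : DifferentiableAt ℝ f x) (hg : DifferentiableAt ℝ g x)
    (j : Fin n) : pd j (fun y => f y + g y) x = pd j f x + pd j g x := by
  simp only [pd]
  rw [fderiv_fun_add hf hg]
  simp

theorem pd_sub {n : ℕ} {f g : EuclideanSpace ℝ (Fin n) → ℝ}
    {x : EuclideanSpace ℝ (Fin n)} (hf : DifferentiableAt ℝ f x) (hg : DifferentiableAt ℝ g x)
    (j : Fin n) : pd j (fun y => f y - g y) x = pd j f x - pd j g x := by
  simp only [pd]
  rw [fderiv_fun_sub hf hg]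
  simp

theorem pd_neg {n : ℕ} (f : EuclideanSpace ℝ (Fin n) → ℝ) (j : Fin n) :
    pd j (fun y => -f y) = fun y => -pd j f y := by
  ext x
  simp only [pd]
  rw [fderiv_fun_neg]
  simp

theorem pd_const_mul {n : ℕ} {f : EuclideanSpace ℝ (Fin n) → ℝ}
    {x : EuclideanSpace ℝ (Fin n)} (hf : DifferentiableAt ℝ f x) (c : ℝ)
    (j : Fin n) : pd j (fun y => c * f y) x = c * pd j f x := by
  simp only [pd]
  rw [fderiv_const_mul hf]
  simp

theorem pd_mul {n : ℕ} {f g : EuclideanSpace ℝ (Fin n) → ℝ}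
    {x : EuclideanSpace ℝ (Fin n)} (hf : DifferentiableAt ℝ f x) (hg : DifferentiableAt ℝ g x)
    (j : Fin n) : pd j (fun y => f y * g y) x = pd j f x * g x + f x * pd j g x := by
  simp only [pd]
  rw [fderiv_fun_mul hf hg]
  simp
  ring

theorem pd_comm {n : ℕ} {f : EuclideanSpace ℝ (Fin n) → ℝ} (hf : ContDiff ℝ 2 f) (i j : Fin n) :
    pd i (pd j f) = pd j (pd i f) := by
  have h : ∀ (a b : Fin n) x, pd a (pd b f) x =
      fderiv ℝ (fderiv ℝ f) x (EuclideanSpace.single a 1) (EuclideanSpace.single b 1) := by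
    intro a b x
    have h1 : DifferentiableAt ℝ (fderiv ℝ f) x :=
      (hf.fderiv_right (m := 1) (by norm_num)).differentiable one_ne_zero x
    unfold pd
    rw [fderiv_clm_apply h1 (differentiableAt_const _)]
    simp
  ext x
  rw [h, h]
  exact (hf.contDiffAt.isSymmSndFDerivAt (by simp)).eq _ _

theorem hasDerivAt_pd_line {n : ℕ} {f : EuclideanSpace ℝ (Fin n) → ℝ} (hf : Differentiable ℝ f)
    (x : EuclideanSpace ℝ (Fin n)) (j : Fin n) (ξ : ℝ) :
    HasDerivAt (fun ξ : ℝ => f (x + ξ • EuclideanSpace.single j 1))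
      (pd j f (x + ξ • EuclideanSpace.single j 1)) ξ := by
  have h1 : HasDerivAt (fun ξ : ℝ => x + ξ • EuclideanSpace.single j (1:ℝ))
      (EuclideanSpace.single j 1) ξ := by
    simpa using ((hasDerivAt_id ξ).smul_const (EuclideanSpace.single j (1:ℝ))).const_add x
  exact (hf _).hasFDerivAt.comp_hasDerivAt ξ h1

theorem IsLocalMax.pd_pd_nonpos {n : ℕ} {f : EuclideanSpace ℝ (Fin n) → ℝ} (hf : ContDiff ℝ 2 f)
    {x : EuclideanSpace ℝ (Fin n)} (hx : IsLocalMax f x) (j : Fin n) :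
    pd j (pd j f) x ≤ 0 := by
  by_contra! hpos
  set φ : ℝ → ℝ := fun ξ => f (x + ξ • EuclideanSpace.single j 1) with hφ
  have hd : deriv φ = fun ξ => pd j f (x + ξ • EuclideanSpace.single j 1) :=
    funext fun ξ => (hasDerivAt_pd_line (hf.differentiable two_ne_zero) x j ξ).deriv
  have hdd : deriv (deriv φ) = fun ξ => pd j (pd j f) (x + ξ • EuclideanSpace.single j 1) := by
    rw [hd]
    exact funext fun ξ => (hasDerivAt_pd_line ((contDiff_pd (m := 1) hf (by norm_num) j).differentiable
      one_ne_zero) x j ξ).deriv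
  have hc : Continuous fun ξ : ℝ => x + ξ • EuclideanSpace.single j (1:ℝ) := by fun_prop
  have hφc : Continuous φ := hf.continuous.comp hc
  have hmax : IsLocalMax φ 0 := by
    have : Tendsto (fun ξ : ℝ => x + ξ • EuclideanSpace.single j (1:ℝ)) (𝓝 0) (𝓝 x) := by
      simpa using hc.tendsto 0
    have h2 := this.eventually hx
    simpa [IsLocalMax, IsMaxFilter, hφ] using h2
  have hmin : IsLocalMin φ 0 :=
    isLocalMin_of_deriv_deriv_pos (by simpa [hdd] using hpos) hmax.deriv_eq_zero
      hφc.continuousAt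
  have hconst : φ =ᶠ[𝓝 0] fun _ => φ 0 := by
    filter_upwards [hmax, hmin] with ξ h1 h2
    exact le_antisymm h1 h2
  have h0 : deriv (deriv φ) 0 = 0 := by
    rw [hconst.deriv.deriv_eq]
    simp
  rw [hdd] at h0
  simp only [zero_smul, add_zero] at h0
  exact hpos.ne' h0

end PartialDerivatives

section ParabolicMaximum

theorem nonpos_of_parabolic {n : ℕ} {ν T C : ℝ} (hν : 0 ≤ ν) (hT : 0 < T)
    {D : ℝ → EuclideanSpace ℝ (Fin n) → ℝ} {b : ℝ → EuclideanSpace ℝ (Fin n) → Fin n → ℝ}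
    (hc : ContinuousOn (fun p : ℝ × EuclideanSpace ℝ (Fin n) => D p.1 p.2) (Icc 0 T ×ˢ univ))
    (h0 : ∀ x, D 0 x = 0) (hdec : ∀ t ∈ Icc 0 T, DecaysWith C (D t))
    (hD : ∀ t ∈ Icc 0 T, ContDiff ℝ 2 (D t))
    (hdt : ∀ t ∈ Icc 0 T, ∀ x, HasDerivWithinAt (fun s => D s x)
      (ν * ∑ j, pd j (pd j (D t)) x - ∑ j, b t x j * pd j (D t) x) (Icc 0 T) t) :
    ∀ t ∈ Icc 0 T, ∀ x, D t x ≤ 0 := by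
  intro t₁ ht₁ x₁
  by_contra! hm
  set m := D t₁ x₁ with hmdef
  set ε := m / (2 * T) with hε
  have hεpos : 0 < ε := by positivity
  have hεT : ε * T = m / 2 := by rw [hε]; field_simp
  have hC : 0 ≤ C := (hdec t₁ ht₁).nonneg
  obtain ⟨R, hR0, hRx, hR⟩ : ∃ R, 0 ≤ R ∧ ‖x₁‖ ≤ R ∧ C * ((1 + R) ^ 5)⁻¹ < m / 2 := by
    have h1 : ∀ᶠ R : ℝ in atTop, C * ((1 + R) ^ 5)⁻¹ < m / 2 := by
      have := tendsto_inv_one_add_pow.const_mul C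
      rw [mul_zero] at this
      exact this.eventually_lt_const (by positivity)
    exact ((eventually_ge_atTop 0).and ((eventually_ge_atTop ‖x₁‖).and h1)).exists
  have hφ1 : m / 2 ≤ D t₁ x₁ - ε * t₁ := by
    have : ε * t₁ ≤ ε * T := mul_le_mul_of_nonneg_left ht₁.2 hεpos.le
    linarith
  obtain ⟨⟨t₀, x₀⟩, ⟨ht₀, -⟩, hmax⟩ :=
    (isCompact_Icc.prod (isCompact_closedBall (0 : EuclideanSpace ℝ (Fin n)) R)).exists_isMaxOn
      (s := Icc 0 T ×ˢ Metric.closedBall (0 : EuclideanSpace ℝ (Fin n)) R)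
      (f := fun p => D p.1 p.2 - ε * p.1) ⟨(t₁, x₁), ht₁, by simpa using hRx⟩
      ((hc.mono (prod_mono_right (subset_univ _))).sub (by fun_prop))
  replace ht₀ : t₀ ∈ Icc 0 T := ht₀
  have hball : ∀ t ∈ Icc 0 T, ∀ x, ‖x‖ ≤ R → D t x - ε * t ≤ D t₀ x₀ - ε * t₀ :=
    fun t ht x hx => hmax (show (t, x) ∈ _ from ⟨ht, by simpa using hx⟩)
  have hm0 : m / 2 ≤ D t₀ x₀ - ε * t₀ := hφ1.trans (hball t₁ ht₁ x₁ hRx)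
  have hglob : ∀ t ∈ Icc 0 T, ∀ x, D t x - ε * t ≤ D t₀ x₀ - ε * t₀ := by
    intro t ht x
    rcases le_or_gt ‖x‖ R with hx | hx
    · exact hball t ht x hx
    · have h1 := (le_abs_self _).trans (hdec t ht x)
      have h2 : C * ((1 + ‖x‖) ^ 5)⁻¹ ≤ C * ((1 + R) ^ 5)⁻¹ := by gcongr
      have h3 : 0 ≤ ε * t := mul_nonneg hεpos.le ht.1
      linarith
  have ht₀pos : 0 < t₀ := by
    rcases ht₀.1.eq_or_lt with h | h
    · rw [← h, h0] at hm0
      linarith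
    · exact h
  have hxmax : IsLocalMax (D t₀) x₀ := .of_forall fun x => by
    have := hglob t₀ ht₀ x
    linarith
  have hgrad : ∀ j, pd j (D t₀) x₀ = 0 := fun j => by
    rw [pd, hxmax.fderiv_eq_zero]; rfl
  have hlap : ∑ j, pd j (pd j (D t₀)) x₀ ≤ 0 :=
    Finset.sum_nonpos fun j _ => hxmax.pd_pd_nonpos (hD t₀ ht₀) j
  have hder := (hdt t₀ ht₀ x₀).sub ((hasDerivWithinAt_id t₀ (Icc 0 T)).const_mul ε)
  have htmax : IsLocalMaxOn (fun s => D s x₀ - ε * id s) (Icc 0 T) t₀ := by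
    filter_upwards [self_mem_nhdsWithin] with s hs
    exact hglob s hs x₀
  have hcone : (0 - t₀) ∈ posTangentConeAt (Icc 0 T) t₀ :=
    sub_mem_posTangentConeAt_of_segment_subset
      ((convex_Icc 0 T).segment_subset ht₀ (left_mem_Icc.2 hT.le))
  have h := htmax.hasFDerivWithinAt_nonpos hder.hasFDerivWithinAt hcone
  simp only [hgrad, mul_zero, Finset.sum_const_zero, sub_zero, mul_one, zero_sub,
    ContinuousLinearMap.toSpanSingleton_apply, smul_eq_mul] at h
  have h5 := mul_nonpos_of_nonneg_of_nonpos hν hlap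
  nlinarith

theorem eq_zero_of_parabolic {n : ℕ} {ν T C : ℝ} (hν : 0 ≤ ν) (hT : 0 < T)
    {D : ℝ → EuclideanSpace ℝ (Fin n) → ℝ} {b : ℝ → EuclideanSpace ℝ (Fin n) → Fin n → ℝ}
    (hc : ContinuousOn (fun p : ℝ × EuclideanSpace ℝ (Fin n) => D p.1 p.2) (Icc 0 T ×ˢ univ))
    (h0 : ∀ x, D 0 x = 0) (hdec : ∀ t ∈ Icc 0 T, DecaysWith C (D t))
    (hD : ∀ t ∈ Icc 0 T, ContDiff ℝ 2 (D t))
    (hdt : ∀ t ∈ Icc 0 T, ∀ x, HasDerivWithinAt (fun s => D s x)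
      (ν * ∑ j, pd j (pd j (D t)) x - ∑ j, b t x j * pd j (D t) x) (Icc 0 T) t) :
    ∀ t ∈ Icc 0 T, ∀ x, D t x = 0 := by
  intro t ht x
  refine le_antisymm (nonpos_of_parabolic hν hT hc h0 hdec hD hdt t ht x) ?_
  have h := nonpos_of_parabolic (D := fun t x => -D t x) (b := b) hν hT hc.neg (by simpa using h0)
    (fun t ht x => by simpa using hdec t ht x) (fun t ht => (hD t ht).neg) (fun t ht x => ?_)
    t ht x
  · linarith
  · refine (hdt t ht x).neg.congr_deriv ?_
    simp only [pd_neg, Finset.sum_neg_distrib, mul_neg]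
    ring

theorem hasDerivWithinAt_of_hasDerivAt_param {T B : ℝ} (hT : 0 < T) {u w w' : ℝ → ℝ → ℝ}
    {u' : ℝ → ℝ}
    (hu : ∀ t ∈ Icc 0 T, ∀ ξ, HasDerivWithinAt (fun s => u s ξ) (w t ξ) (Icc 0 T) t)
    (hwt : ∀ ξ, ContinuousOn (fun t => w t ξ) (Icc 0 T))
    (hw : ∀ t ∈ Icc 0 T, ∀ ξ, HasDerivAt (w t) (w' t ξ) ξ)
    (hB : ∀ t ∈ Icc 0 T, ∀ ξ ∈ Metric.ball (0:ℝ) 1, |w' t ξ| ≤ B)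
    (hwt' : ContinuousOn (fun t => w' t 0) (Icc 0 T))
    (hu' : ∀ t ∈ Icc 0 T, HasDerivAt (u t) (u' t) 0) {t : ℝ} (ht : t ∈ Icc 0 T) :
    HasDerivWithinAt u' (w' t 0) (Icc 0 T) t := by
  have hsub : ∀ {s}, s ∈ Icc 0 T → Icc 0 s ⊆ Icc 0 T := fun hs => Icc_subset_Icc_right hs.2
  have hinteg : ∀ s ∈ Icc 0 T, ∀ ξ, IntervalIntegrable (fun τ => w τ ξ) volume 0 s := fun s hs ξ =>
    ((hwt ξ).mono (hsub hs)).intervalIntegrable_of_Icc hs.1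
  have hftc : ∀ s ∈ Icc 0 T, ∀ ξ, ∫ τ in (0:ℝ)..s, w τ ξ = u s ξ - u 0 ξ := by
    intro s hs ξ
    refine intervalIntegral.integral_eq_sub_of_hasDerivAt_of_le hs.1
      (fun τ hτ => ((hu τ (hsub hs hτ) ξ).continuousWithinAt).mono (hsub hs))
      (fun τ hτ => ?_) (hinteg s hs ξ)
    have hτ' : τ ∈ Ioo 0 T := ⟨hτ.1, hτ.2.trans_le hs.2⟩
    exact (hu τ (Ioo_subset_Icc_self hτ') ξ).hasDerivAt (Icc_mem_nhds hτ'.1 hτ'.2)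
  have hdiff : ∀ s ∈ Icc 0 T, u' s = u' 0 + ∫ τ in (0:ℝ)..s, w' τ 0 := by
    intro s hs
    have hmem : ∀ {τ}, τ ∈ uIoc 0 s → τ ∈ Icc 0 T := fun hτ => by
      rw [uIoc_of_le hs.1] at hτ
      exact hsub hs (Ioc_subset_Icc_self hτ)
    have h1 := (intervalIntegral.hasDerivAt_integral_of_dominated_loc_of_deriv_le
      (F := fun ξ τ => w τ ξ) (F' := fun ξ τ => w' τ ξ) (bound := fun _ => B) (a := 0) (b := s)
      (μ := volume) (Metric.ball_mem_nhds (0:ℝ) one_pos)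
      (.of_forall fun ξ => (intervalIntegrable_iff.1 (hinteg s hs ξ)).aestronglyMeasurable) (hinteg s hs 0)
      (intervalIntegrable_iff.1
        ((hwt'.mono (hsub hs)).intervalIntegrable_of_Icc hs.1)).aestronglyMeasurable
      (.of_forall fun τ hτ ξ hξ => hB τ (hmem hτ) ξ hξ) intervalIntegrable_const
      (.of_forall fun τ hτ ξ _ => hw τ (hmem hτ) ξ)).2
    have h2 : HasDerivAt (fun ξ => ∫ τ in (0:ℝ)..s, w τ ξ) (u' s - u' 0) 0 := by
      simp only [hftc s hs]
      exact (hu' s hs).sub (hu' 0 (left_mem_Icc.2 hT.le))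
    linarith [h1.unique h2]
  set f : ℝ → ℝ := IccExtend hT.le ((Icc 0 T).domRestrict fun τ => w' τ 0) with hf
  have hfc : Continuous f := (continuousOn_iff_continuous_domRestrict.1 hwt').Icc_extend'
  have hfeq : ∀ τ ∈ Icc 0 T, f τ = w' τ 0 := fun τ hτ => by
    rw [hf, IccExtend_of_mem _ _ hτ]; rfl
  have h3 : HasDerivWithinAt (fun s => u' 0 + ∫ τ in (0:ℝ)..s, f τ) (f t) (Icc 0 T) t :=
    ((hfc.integral_hasStrictDerivAt 0 t).hasDerivAt.const_add _).hasDerivWithinAt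
  rw [hfeq t ht] at h3
  refine h3.congr_of_mem (fun s hs => ?_) ht
  rw [hdiff s hs]
  congr 1
  refine intervalIntegral.integral_congr fun τ hτ => (hfeq τ ?_).symm
  rw [uIcc_of_le hs.1] at hτ
  exact hsub hs hτ

end ParabolicMaximum

section LerayForm

/-- The source term of the pressure equation. -/
noncomputable def quadSource {n : ℕ} (u : EuclideanSpace ℝ (Fin n) → Fin n → ℝ)
    (y : EuclideanSpace ℝ (Fin n)) : ℝ :=
  ∑ j, ∑ k, pd j (fun z => u z k) y * pd k (fun z => u z j) y

theorem integral_sub_mul_eq {n : ℕ} (k g : EuclideanSpace ℝ (Fin n) → ℝ)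
    (x : EuclideanSpace ℝ (Fin n)) : ∫ y, k (x - y) * g y = ∫ y, k y * g (x - y) := by
  rw [← integral_sub_left_eq_self (fun y => k y * g (x - y)) volume x]
  simp

variable {n : ℕ} {u : EuclideanSpace ℝ (Fin n) → Fin n → ℝ}

theorem contDiff_quadSource (hu : ∀ i, ContDiff ℝ 3 (fun x => u x i)) :
    ContDiff ℝ 2 (quadSource u) :=
  ContDiff.sum fun _ _ => ContDiff.sum fun _ _ =>
    (contDiff_pd (hu _) (by norm_num) _).mul (contDiff_pd (hu _) (by norm_num) _)

theorem pd_quadSource (hu : ∀ i, ContDiff ℝ 3 (fun x => u x i)) (i : Fin n)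
    (x : EuclideanSpace ℝ (Fin n)) :
    pd i (quadSource u) x = ∑ j, ∑ k,
      (pd i (pd j fun z => u z k) x * pd k (fun z => u z j) x +
        pd j (fun z => u z k) x * pd i (pd k fun z => u z j) x) := by
  have hd : ∀ j k, DifferentiableAt ℝ (pd j fun z => u z k) x := fun j k =>
    (contDiff_pd (m := 2) (hu k) (by norm_num) j).differentiable two_ne_zero x
  unfold quadSource
  rw [pd_sum _ fun j _ => DifferentiableAt.fun_sum fun k _ => (hd j k).fun_mul (hd k j)]
  refine Finset.sum_congr rfl fun j _ => ?_
  rw [pd_sum _ fun k _ => (hd j k).fun_mul (hd k j)]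
  exact Finset.sum_congr rfl fun k _ => pd_mul (hd j k) (hd k j) i

theorem DecaysWith.abs_le {C : ℝ} {g : EuclideanSpace ℝ (Fin n) → ℝ} (hg : DecaysWith C g)
    (x : EuclideanSpace ℝ (Fin n)) : |g x| ≤ C := by
  refine (hg x).trans (mul_le_of_le_one_right hg.nonneg (inv_le_one_of_one_le₀ ?_))
  exact one_le_pow₀ (by linarith [norm_nonneg x])

theorem DecaysWith.mul {C C' : ℝ} {f g : EuclideanSpace ℝ (Fin n) → ℝ}
    (hf : DecaysWith C f) (hg : DecaysWith C' g) : DecaysWith (C * C') fun x => f x * g x :=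
  fun x => by
    rw [norm_mul, mul_assoc]
    exact mul_le_mul (hf.abs_le x) (hg x) (norm_nonneg _) hf.nonneg

theorem DecaysWith.add {C C' : ℝ} {f g : EuclideanSpace ℝ (Fin n) → ℝ}
    (hf : DecaysWith C f) (hg : DecaysWith C' g) : DecaysWith (C + C') fun x => f x + g x :=
  fun x => by
    rw [add_mul]
    exact (norm_add_le _ _).trans (add_le_add (hf x) (hg x))

theorem DecaysWith.sum {C : ℝ} {f : Fin n → EuclideanSpace ℝ (Fin n) → ℝ}
    (hf : ∀ i, DecaysWith C (f i)) : DecaysWith (n * C) fun x => ∑ i, f i x := fun x => by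
  refine (norm_sum_le _ _).trans ((Finset.sum_le_sum fun i _ => hf i x).trans ?_)
  simp [mul_assoc]

theorem decaysWith_quadSource {C : ℝ}
    (hu : ∀ i, ∀ α : List (Fin n), α.length ≤ 3 → DecaysWith C (pdIter α fun y => u y i)) :
    DecaysWith (n * (n * (C * C))) (quadSource u) :=
  DecaysWith.sum fun j => DecaysWith.sum fun k => (hu k [j] (by simp)).mul (hu j [k] (by simp))

theorem decaysWith_pd_quadSource (hu3 : ∀ i, ContDiff ℝ 3 (fun x => u x i)) {C : ℝ}
    (hu : ∀ i, ∀ α : List (Fin n), α.length ≤ 3 → DecaysWith C (pdIter α fun y => u y i))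
    (i : Fin n) : DecaysWith (n * (n * (C * C + C * C))) (pd i (quadSource u)) := by
  rw [funext (pd_quadSource hu3 i)]
  exact DecaysWith.sum fun j => DecaysWith.sum fun k =>
    ((hu k [i, j] (by simp)).mul (hu j [k] (by simp))).add
      ((hu k [j] (by simp)).mul (hu j [i, k] (by simp)))

/-- The spatial partial derivative of the right-hand side of the evolution equation. -/
theorem pd_leray_rhs (hn : 3 ≤ n) (ν : ℝ) (hu3 : ∀ i, ContDiff ℝ 3 (fun x => u x i)) {C : ℝ}
    (hu : ∀ i, ∀ α : List (Fin n), α.length ≤ 3 → DecaysWith C (pdIter α fun y => u y i))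
    (i l : Fin n) (x : EuclideanSpace ℝ (Fin n)) :
    DifferentiableAt ℝ (fun x => ν * (∑ j, pd j (pd j fun y => u y i) x)
        - ∑ j, u x j * pd j (fun y => u y i) x
        + ∫ y, poissonKGrad n i y * quadSource u (x - y)) x ∧
      pd l (fun x => ν * (∑ j, pd j (pd j fun y => u y i) x)
        - ∑ j, u x j * pd j (fun y => u y i) x
        + ∫ y, poissonKGrad n i y * quadSource u (x - y)) x =
      ν * (∑ j, pd l (pd j (pd j fun y => u y i)) x)
        - ∑ j, (pd l (fun y => u y j) x * pd j (fun y => u y i) x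
          + u x j * pd l (pd j fun y => u y i) x)
        + ∫ y, poissonKGrad n i y * pd l (quadSource u) (x - y) := by
  have hd0 : ∀ k, DifferentiableAt ℝ (fun z => u z k) x := fun k =>
    (hu3 k).differentiable (by norm_num) x
  have hd1 : ∀ j k, DifferentiableAt ℝ (pd j fun z => u z k) x := fun j k =>
    (contDiff_pd (m := 2) (hu3 k) (by norm_num) j).differentiable two_ne_zero x
  have hd2 : ∀ i j k, DifferentiableAt ℝ (pd i (pd j fun z => u z k)) x := fun i j k =>
    (contDiff_pd (m := 1) (contDiff_pd (m := 2) (hu3 k) (by norm_num) j)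
      (by norm_num) i).differentiable one_ne_zero x
  have hlap : DifferentiableAt ℝ (fun x => ∑ j, pd j (pd j fun y => u y i) x) x :=
    DifferentiableAt.fun_sum fun j _ => hd2 j j i
  have hconv : DifferentiableAt ℝ (fun x => ∑ j, u x j * pd j (fun y => u y i) x) x :=
    DifferentiableAt.fun_sum fun j _ => (hd0 j).fun_mul (hd1 j i)
  have hF := (tamedKernel_poissonKGrad hn i).hasFDerivAt_pd (decaysWith_quadSource hu)
    ((contDiff_quadSource hu3).of_le (by norm_num)) (decaysWith_pd_quadSource hu3 hu) x
  refine ⟨((hlap.const_mul ν).fun_sub hconv).fun_add hF.1, ?_⟩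
  rw [pd_add ((hlap.const_mul ν).fun_sub hconv) hF.1, pd_sub (hlap.const_mul ν) hconv,
    pd_const_mul hlap, pd_sum _ fun j _ => hd2 j j i, pd_sum _ fun j _ => (hd0 j).fun_mul (hd1 j i),
    hF.2]
  congr 2
  exact Finset.sum_congr rfl fun j _ => pd_mul (hd0 j) (hd1 j i) l

/-- Taking the divergence of the Leray form, the source term cancels. -/
theorem sum_pd_leray_rhs (hn : 3 ≤ n) (ν : ℝ) (hu3 : ∀ i, ContDiff ℝ 3 (fun x => u x i)) {C : ℝ}
    (hu : ∀ i, ∀ α : List (Fin n), α.length ≤ 3 → DecaysWith C (pdIter α fun y => u y i))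
    (x : EuclideanSpace ℝ (Fin n)) :
    ∑ i, (ν * (∑ j, pd i (pd j (pd j fun y => u y i)) x)
        - ∑ j, (pd i (fun y => u y j) x * pd j (fun y => u y i) x
          + u x j * pd i (pd j fun y => u y i) x)
        + ∫ y, poissonKGrad n i y * pd i (quadSource u) (x - y)) =
      ν * ∑ j, pd j (pd j fun z => ∑ i, pd i (fun y => u y i) z) x
        - ∑ j, u x j * pd j (fun z => ∑ i, pd i (fun y => u y i) z) x := by
  have hd1 : ∀ j k, Differentiable ℝ (pd j fun z => u z k) := fun j k =>
    (contDiff_pd (m := 2) (hu3 k) (by norm_num) j).differentiable two_ne_zero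
  have hd2 : ∀ i j k, Differentiable ℝ (pd i (pd j fun z => u z k)) := fun i j k =>
    (contDiff_pd (m := 1) (contDiff_pd (m := 2) (hu3 k) (by norm_num) j)
      (by norm_num) i).differentiable one_ne_zero
  have hp1 : ∀ j, pd j (fun z => ∑ i, pd i (fun y => u y i) z) =
      fun z => ∑ i, pd j (pd i fun y => u y i) z := fun j =>
    funext fun z => pd_sum _ (fun i _ => hd1 i i z) j
  have hp2 : ∀ j, pd j (pd j fun z => ∑ i, pd i (fun y => u y i) z) x =
      ∑ i, pd i (pd j (pd j fun y => u y i)) x := fun j => by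
    rw [hp1, pd_sum _ fun i _ => hd2 j i i x]
    refine Finset.sum_congr rfl fun i _ => ?_
    rw [pd_comm (contDiff_pd (m := 2) (hu3 i) (by norm_num) j) i j,
      pd_comm ((hu3 i).of_le (by norm_num)) i j]
  have hfund := sum_integral_poissonKGrad_mul_pd hn (decaysWith_quadSource hu)
    ((contDiff_quadSource hu3).of_le (by norm_num)) (decaysWith_pd_quadSource hu3 hu) x
  simp only [hp2]
  simp only [hp1]
  rw [Finset.sum_add_distrib, hfund, Finset.sum_sub_distrib, ← Finset.mul_sum]
  simp only [Finset.sum_add_distrib, Finset.mul_sum]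
  rw [Finset.sum_comm (f := fun j i => ν * pd i (pd j (pd j fun y => u y i)) x),
    Finset.sum_comm (f := fun j i => u x j * pd j (pd i fun y => u y i) x)]
  have hc : ∑ i, ∑ j, u x j * pd i (pd j fun y => u y i) x =
      ∑ i, ∑ j, u x j * pd j (pd i fun y => u y i) x :=
    Finset.sum_congr rfl fun i _ => Finset.sum_congr rfl fun j _ => by
      rw [pd_comm ((hu3 i).of_le (by norm_num)) i j]
  rw [hc]
  simp only [quadSource]
  ring

theorem pd_nsPressure (hn : 3 ≤ n) {v : ℝ → EuclideanSpace ℝ (Fin n) → Fin n → ℝ} {t : ℝ}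
    (hu3 : ∀ i, ContDiff ℝ 3 (fun x => v t x i)) {C : ℝ}
    (hu : ∀ i, ∀ α : List (Fin n), α.length ≤ 3 → DecaysWith C (pdIter α fun y => v t y i))
    (i : Fin n) (x : EuclideanSpace ℝ (Fin n)) :
    -pd i (nsPressure v t) x = ∫ y, poissonKGrad n i (x - y) * quadSource (v t) y := by
  have h1 : nsPressure v t = fun x => -∫ y, poissonK n y * quadSource (v t) (x - y) :=
    funext fun x => congrArg Neg.neg (integral_sub_mul_eq (poissonK n) (quadSource (v t)) x)
  have hg1 := (contDiff_quadSource hu3).of_le (m := 1) (by norm_num)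
  rw [h1, pd_neg, neg_neg, ((tamedKernel_poissonK hn).hasFDerivAt_pd (decaysWith_quadSource hu)
    hg1 (decaysWith_pd_quadSource hu3 hu) x).2 i,
    integral_poissonK_mul_pd hn (decaysWith_quadSource hu) hg1
      (decaysWith_pd_quadSource hu3 hu) x i, integral_sub_mul_eq]

end LerayForm

section DivergenceEvolution

variable {n : ℕ} {ν T C : ℝ} {v vt : ℝ → EuclideanSpace ℝ (Fin n) → Fin n → ℝ}

/-- Spatial and time derivatives of a solution of the evolution equation commute. -/
theorem hasDerivWithinAt_pd (hn : 3 ≤ n) (hT : 0 < T)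
    (hdt : ∀ i x, ∀ t ∈ Icc 0 T, HasDerivWithinAt (fun s => v s x i) (vt t x i) (Icc 0 T) t)
    (hct : ∀ i x, ContinuousOn (fun t => vt t x i) (Icc 0 T))
    (hsp : ∀ t ∈ Icc 0 T, ∀ i, ContDiff ℝ 3 (fun x => v t x i))
    (hcd : ∀ i, ∀ α : List (Fin n), α.length ≤ 3 → ∀ x,
      ContinuousOn (fun t => pdIter α (fun y => v t y i) x) (Icc 0 T))
    (hdec : ∀ t ∈ Icc 0 T, ∀ i, ∀ α : List (Fin n), α.length ≤ 3 →
      DecaysWith C (pdIter α fun y => v t y i))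
    (heq : ∀ t ∈ Icc 0 T, ∀ i x, vt t x i =
      ν * (∑ j, pd j (pd j fun y => v t y i) x)
        - ∑ j, v t x j * pd j (fun y => v t y i) x
        + ∫ y, poissonKGrad n i y * quadSource (v t) (x - y))
    (i l : Fin n) {t : ℝ} (ht : t ∈ Icc 0 T) (x : EuclideanSpace ℝ (Fin n)) :
    HasDerivWithinAt (fun s => pd l (fun y => v s y i) x)
      (ν * (∑ j, pd l (pd j (pd j fun y => v t y i)) x)
        - ∑ j, (pd l (fun y => v t y j) x * pd j (fun y => v t y i) x
          + v t x j * pd l (pd j fun y => v t y i) x)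
        + ∫ y, poissonKGrad n i y * pd l (quadSource (v t)) (x - y)) (Icc 0 T) t := by
  set A₁ : ℝ → EuclideanSpace ℝ (Fin n) → ℝ := fun t x =>
    ∑ j, pd l (pd j (pd j fun y => v t y i)) x
  set A₂ : ℝ → EuclideanSpace ℝ (Fin n) → ℝ := fun t x =>
    ∑ j, (pd l (fun y => v t y j) x * pd j (fun y => v t y i) x
          + v t x j * pd l (pd j fun y => v t y i) x)
  set A₃ : ℝ → EuclideanSpace ℝ (Fin n) → ℝ := fun t x =>
    ∫ y, poissonKGrad n i y * pd l (quadSource (v t)) (x - y)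
  have hd₁ : ∀ t ∈ Icc 0 T, DecaysWith (n * C) (A₁ t) := fun t ht =>
    DecaysWith.sum fun j => hdec t ht i [l, j, j] (by simp)
  have hd₂ : ∀ t ∈ Icc 0 T, DecaysWith (n * (C * C + C * C)) (A₂ t) := fun t ht =>
    DecaysWith.sum fun j =>
      ((hdec t ht j [l] (by simp)).mul (hdec t ht i [j] (by simp))).add
        ((hdec t ht j [] (by simp)).mul (hdec t ht i [l, j] (by simp)))
  have hdq : ∀ t ∈ Icc 0 T, DecaysWith (n * (n * (C * C + C * C))) (pd l (quadSource (v t))) :=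
    fun t ht => decaysWith_pd_quadSource (hsp t ht) (hdec t ht) l
  have hc₁ : ContinuousOn (fun t => A₁ t x) (Icc 0 T) :=
    continuousOn_finsetSum _ fun j _ => hcd i [l, j, j] (by simp) x
  have hc₂ : ContinuousOn (fun t => A₂ t x) (Icc 0 T) :=
    continuousOn_finsetSum _ fun j _ =>
      ((hcd j [l] (by simp) x).mul (hcd i [j] (by simp) x)).add
        ((hcd j [] (by simp) x).mul (hcd i [l, j] (by simp) x))
  have hcq : ∀ y, ContinuousOn (fun t => pd l (quadSource (v t)) y) (Icc 0 T) := fun y => by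
    refine ContinuousOn.congr (f := fun t => ∑ j, ∑ k,
      (pdIter [l, j] (fun z => v t z k) y * pdIter [k] (fun z => v t z j) y +
        pdIter [j] (fun z => v t z k) y * pdIter [l, k] (fun z => v t z j) y)) ?_
      fun t ht => pd_quadSource (hsp t ht) l y
    exact continuousOn_finsetSum _ fun j _ => continuousOn_finsetSum _ fun k _ =>
      ((hcd k [l, j] (by simp) y).mul (hcd j [k] (by simp) y)).add
        ((hcd k [j] (by simp) y).mul (hcd j [l, k] (by simp) y))
  have hc₃ : ContinuousOn (fun t => A₃ t x) (Icc 0 T) :=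
    (tamedKernel_poissonKGrad hn i).continuousOn_integral hdq
      (fun t ht => (contDiff_pd (m := 1) (contDiff_quadSource (hsp t ht))
        (by norm_num) l).continuous) hcq x
  have key := hasDerivWithinAt_of_hasDerivAt_param hT
    (u := fun t ξ => v t (x + ξ • EuclideanSpace.single l 1) i)
    (w := fun t ξ => vt t (x + ξ • EuclideanSpace.single l 1) i)
    (w' := fun t ξ => ν * A₁ t (x + ξ • EuclideanSpace.single l 1)
      - A₂ t (x + ξ • EuclideanSpace.single l 1) + A₃ t (x + ξ • EuclideanSpace.single l 1))
    (u' := fun t => pd l (fun y => v t y i) x)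
    (B := |ν| * (n * C) + n * (C * C + C * C) + n * (n * (C * C + C * C)) * (1 + (‖x‖ + 1)) ^ 5 *
      ∫ y, |poissonKGrad n i y| * ((1 + ‖y‖) ^ 5)⁻¹)
    (fun t ht ξ => hdt i _ t ht) (fun ξ => hct i _) (fun t ht ξ => ?_) (fun t ht ξ hξ => ?_) ?_
    (fun t ht => ?_) ht
  · simpa using key
  · have hrhs := fun z => pd_leray_rhs hn ν (hsp t ht) (hdec t ht) i l z
    have h1 := hasDerivAt_pd_line (fun z => (hrhs z).1) x l ξ
    rw [(hrhs _).2] at h1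
    exact h1.congr_of_eventuallyEq (.of_forall fun _ => heq t ht i _)
  · have hz : ‖x + ξ • EuclideanSpace.single l (1:ℝ)‖ ≤ ‖x‖ + 1 := by
      refine (norm_add_le _ _).trans (add_le_add le_rfl ?_)
      rw [norm_smul]
      simpa using (mem_ball_zero_iff.1 hξ).le
    have h1 := (hd₁ t ht).abs_le (x + ξ • EuclideanSpace.single l (1:ℝ))
    have h2 := (hd₂ t ht).abs_le (x + ξ • EuclideanSpace.single l (1:ℝ))
    have h3 := (tamedKernel_poissonKGrad hn i).abs_integral_le (hdq t ht) hz
    refine (abs_add_le _ _).trans (add_le_add ((abs_sub _ _).trans (add_le_add ?_ h2)) h3)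
    rw [abs_mul]
    gcongr
  · simpa using ((hc₁.const_mul ν).fun_sub hc₂).fun_add hc₃
  · simpa using hasDerivAt_pd_line ((hsp t ht i).differentiable (by norm_num)) x l 0

end DivergenceEvolution

/-- a sufficiently regular and decaying classical solution of the Leray
projection form of the Navier–Stokes equation with divergence-free Schwartz data is
divergence free and, together with the Poisson-kernel pressure, solves the incompressible
Navier–Stokes equations. -/
theorem leray_form_yields_navier_stokes
    (n : ℕ) (hn : 3 ≤ n) (ν : ℝ) (hν : 0 < ν)
    (h : Fin n → SchwartzMap (EuclideanSpace ℝ (Fin n)) ℝ)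
    (hdiv0 : ∀ x, ∑ i, pd i (fun y => h i y) x = 0)
    (v vt : ℝ → EuclideanSpace ℝ (Fin n) → Fin n → ℝ)
    -- regularity: continuity of v and of its time derivative
    (hco : ∀ i, ContinuousOn (fun p : ℝ × EuclideanSpace ℝ (Fin n) => v p.1 p.2 i)
      (Ici 0 ×ˢ univ))
    (hdt : ∀ i x, ∀ t ∈ Ici (0:ℝ), HasDerivWithinAt (fun s => v s x i) (vt t x i) (Ici 0) t)
    (hct : ∀ i, ContinuousOn (fun p : ℝ × EuclideanSpace ℝ (Fin n) => vt p.1 p.2 i)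
      (Ici 0 ×ˢ univ))
    -- continuous bounded spatial partial derivatives up to third order
    (hsp : ∀ i, ∀ t ∈ Ici (0:ℝ), ContDiff ℝ 3 (fun x => v t x i))
    (hcd : ∀ i, ∀ α : List (Fin n), α.length ≤ 3 → ContinuousOn
      (fun p : ℝ × EuclideanSpace ℝ (Fin n) => pdIter α (fun y => v p.1 y i) p.2)
      (Ici 0 ×ˢ univ))
    (hbd : ∃ C : ℝ, ∀ t ∈ Ici (0:ℝ), ∀ x i, ∀ α : List (Fin n), α.length ≤ 3 →
      |pdIter α (fun y => v t y i) x| ≤ C)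
    -- polynomial decay of order 5 of the spatial derivatives up to order three,
    -- uniformly for t in compact intervals
    (hdecay : ∀ T : ℝ, 0 < T → ∃ C : ℝ, ∀ t ∈ Icc (0:ℝ) T, ∀ x i,
      ∀ α : List (Fin n), α.length ≤ 3 →
        |pdIter α (fun y => v t y i) x| ≤ C / (1 + ‖x‖) ^ (5:ℕ))
    -- initial data
    (hinit : ∀ x i, v 0 x i = h i x)
    -- the Leray projection form of the Navier–Stokes equation
    (heq : ∀ t ∈ Ici (0:ℝ), ∀ x i,
      vt t x i - ν * (∑ j, pd j (pd j (fun y => v t y i)) x)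
        + ∑ j, v t x j * pd j (fun y => v t y i) x
      = ∫ y, poissonKGrad n i (x - y) *
          ∑ j, ∑ k, pd j (fun z => v t z k) y * pd k (fun z => v t z j) y) :
    (∀ t ∈ Ici (0:ℝ), ∀ x, ∑ i, pd i (fun y => v t y i) x = 0) ∧
    (∀ t ∈ Ici (0:ℝ), ∀ x i,
      vt t x i - ν * (∑ j, pd j (pd j (fun y => v t y i)) x)
        + ∑ j, v t x j * pd j (fun y => v t y i) x
      = - pd i (fun y => nsPressure v t y) x) := by
  have hdw : ∀ T : ℝ, 0 < T → ∃ C : ℝ, ∀ t ∈ Icc 0 T, ∀ i, ∀ α : List (Fin n), α.length ≤ 3 →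
      DecaysWith C (pdIter α fun y => v t y i) := fun T hT => by
    obtain ⟨C, hC⟩ := hdecay T hT
    exact ⟨C, fun t ht i α hα x => (hC t ht x i α hα).trans_eq (div_eq_mul_inv _ _)⟩
  refine ⟨fun t ht x => ?_, fun t ht x i => ?_⟩
  · have hT : 0 < t + 1 := by linarith [mem_Ici.1 ht]
    have hsub : Icc 0 (t + 1) ⊆ Ici 0 := Icc_subset_Ici_self
    have hsub2 : Icc 0 (t + 1) ×ˢ univ ⊆ Ici (0:ℝ) ×ˢ (univ : Set (EuclideanSpace ℝ (Fin n))) :=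
      prod_mono_left hsub
    have hmap : ∀ x : EuclideanSpace ℝ (Fin n),
        MapsTo (fun s : ℝ => (s, x)) (Icc 0 (t + 1)) (Ici (0:ℝ) ×ˢ univ) :=
      fun x s hs => ⟨hsub hs, mem_univ x⟩
    obtain ⟨C, hC⟩ := hdw (t + 1) hT
    have hsp' : ∀ s ∈ Icc 0 (t + 1), ∀ i, ContDiff ℝ 3 (fun x => v s x i) :=
      fun s hs i => hsp i s (hsub hs)
    refine eq_zero_of_parabolic (D := fun s x => ∑ i, pd i (fun y => v s y i) x) (b := v)
      hν.le hT (continuousOn_finsetSum _ fun i _ => (hcd i [i] (by simp)).mono hsub2)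
      (fun x => ?_) (fun s hs => DecaysWith.sum fun i => hC s hs i [i] (by simp))
      (fun s hs => ContDiff.sum fun i _ => contDiff_pd (hsp' s hs i) (by norm_num) i)
      (fun s hs x => ?_) t ⟨ht, by linarith⟩ x
    · simpa only [hinit] using hdiv0 x
    · rw [← sum_pd_leray_rhs hn ν (hsp' s hs) (hC s hs) x]
      refine HasDerivWithinAt.fun_sum fun i _ => hasDerivWithinAt_pd hn hT
        (fun i x r hr => (hdt i x r (hsub hr)).mono hsub)
        (fun i x => (hct i).comp (by fun_prop) (hmap x)) hsp'
        (fun i α hα x => (hcd i α hα).comp (by fun_prop) (hmap x)) hC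
        (fun r hr i x => ?_) i i hs x
      rw [← integral_sub_mul_eq]
      have h1 := heq r (hsub hr) x i
      simp only [quadSource]
      linarith
  · have hT : 0 < t + 1 := by linarith [mem_Ici.1 ht]
    obtain ⟨C, hC⟩ := hdw (t + 1) hT
    have ht' : t ∈ Icc 0 (t + 1) := ⟨ht, by linarith⟩
    rw [heq t ht x i]
    exact (pd_nsPressure hn (fun i => hsp i t ht) (hC t ht') i x).symm
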